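/- Let G ⊆ U(n) be a finite group whose n-dimensional representation has fixity one (i.e., G acts freely on U(n)/U(n-2)). Then G acts freely and smoothly on S^{2n-1} × S^{4n-5}. -/

import Mathlib

open scoped Manifold

/-- The subgroup `U(k) ⊆ U(n)` of unitary matrices of block form `diag(A, I_{n-k})`,
described as a subset of the unitary group. -/
def blockSet (n k : ℕ) : Set (Matrix.unitaryGroup (Fin n) ℂ) :=
  {U | ∀ i j : Fin n, (k ≤ (i : ℕ) ∨ k ≤ (j : ℕ)) →
    (U : Matrix (Fin n) (Fin n) ℂ) i j = if i = j then 1 else 0}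

noncomputable section
/-- The complex reflection moving the unit vector `u` to the unit vector `p`. -/
def cref {H : Type*} [NormedAddCommGroup H] [InnerProductSpace ℂ H] (u p v : H) : H :=
  v - (inner ℂ (u - p) v * (inner ℂ (u - p) u)⁻¹) • (u - p)

section
variable {H : Type*} [NormedAddCommGroup H] [InnerProductSpace ℂ H]

lemma cref_self (u p : H) (h : inner ℂ (u - p) u ≠ 0) : cref u p u = p := by
  rw [cref, mul_inv_cancel₀ h]; simp

lemma cref_fix (u p v : H) (h : inner ℂ (u - p) v = 0) : cref u p v = v := by
  rw [cref, h]; simp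

lemma cref_den_symm (u p : H) (hu : ‖u‖ = 1) (hp : ‖p‖ = 1) :
    inner ℂ (p - u) p = (starRingEnd ℂ) (inner ℂ (u - p) u) := by
  simp [inner_self_eq_norm_sq_to_K, hu, hp]

lemma cref_den_ne (u p : H) (hu : ‖u‖ = 1) (hp : ‖p‖ = 1) (h : inner ℂ (u - p) u ≠ 0) :
    inner ℂ (p - u) p ≠ 0 := by
  rw [cref_den_symm u p hu hp]
  exact (map_ne_zero (starRingEnd ℂ)).2 h

lemma cref_den_add (u p : H) :
    (inner ℂ (u - p) (u - p) : ℂ) = inner ℂ (u - p) u + inner ℂ (p - u) p := by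
  rw [inner_sub_right, sub_eq_add_neg, ← inner_neg_left, neg_sub]

lemma cref_inv (u p v : H) (hu : ‖u‖ = 1) (hp : ‖p‖ = 1) (h : inner ℂ (u - p) u ≠ 0) :
    cref p u (cref u p v) = v := by
  have h' := cref_den_ne u p hu hp h
  have e : p - u = -(u - p) := by abel
  have hn := cref_den_add u p
  unfold cref
  set a : ℂ := inner ℂ (u - p) u
  set b : ℂ := inner ℂ (p - u) p
  rw [e]
  set w := u - p
  have : inner ℂ (-w) (v - (inner ℂ w v * a⁻¹) • w) * b⁻¹ = inner ℂ w v * a⁻¹ := by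
    rw [inner_neg_left, inner_sub_right, inner_smul_right, hn]
    field_simp
    ring
  rw [this]
  simp

lemma cref_norm (u p v : H) (hu : ‖u‖ = 1) (hp : ‖p‖ = 1) (h : inner ℂ (u - p) u ≠ 0) :
    ‖cref u p v‖ = ‖v‖ := by
  have hs := cref_den_symm u p hu hp
  have h' := cref_den_ne u p hu hp h
  have hn := cref_den_add u p
  have : (inner ℂ (cref u p v) (cref u p v) : ℂ) = inner ℂ v v := by
    unfold cref
    set a : ℂ := inner ℂ (u - p) u
    set b : ℂ := inner ℂ (p - u) p
    set w := u - p
    rw [inner_sub_left, inner_sub_right, inner_sub_right]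
    simp only [inner_smul_left, inner_smul_right, map_mul, map_inv₀]
    rw [← hs, hn, inner_conj_symm]
    field_simp
    ring
  rw [inner_self_eq_norm_sq_to_K, inner_self_eq_norm_sq_to_K] at this
  have h2 : ‖cref u p v‖ ^ 2 = ‖v‖ ^ 2 := by exact_mod_cast this
  exact (sq_eq_sq₀ (norm_nonneg _) (norm_nonneg _)).1 h2

/-- `cref` as a linear isometry. -/
def crefL (u p : H) (hu : ‖u‖ = 1) (hp : ‖p‖ = 1) (h : inner ℂ (u - p) u ≠ 0) : H →ₗᵢ[ℂ] H where
  toFun := cref u p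
  map_add' x y := by
    simp only [cref, inner_add_right, add_mul, add_smul]; abel
  map_smul' c x := by
    simp only [cref, inner_smul_right, smul_sub, smul_smul, mul_assoc, RingHom.id_apply]
  norm_map' v := cref_norm u p v hu hp h

lemma cref_inner (u p v w : H) (hu : ‖u‖ = 1) (hp : ‖p‖ = 1) (h : inner ℂ (u - p) u ≠ 0) :
    inner ℂ (cref u p v) (cref u p w) = inner ℂ v w :=
  (crefL u p hu hp h).inner_map_map v w

lemma cref_contDiffAt {X : Type*} [NormedAddCommGroup X] [NormedSpace ℝ X] {U P W : X → H} {x : X}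
    {m : WithTop ℕ∞}
    (hU : ContDiffAt ℝ m U x) (hP : ContDiffAt ℝ m P x) (hW : ContDiffAt ℝ m W x)
    (h : inner ℂ (U x - P x) (U x) ≠ 0) :
    ContDiffAt ℝ m (fun y => cref (U y) (P y) (W y)) x := by
  unfold cref
  have hd : ContDiffAt ℝ m (fun y => U y - P y) x := hU.sub hP
  have h1 : ContDiffAt ℝ m (fun y => (inner ℂ (U y - P y) (W y) : ℂ)) x := hd.inner ℂ hW
  have h2 : ContDiffAt ℝ m (fun y => (inner ℂ (U y - P y) (U y) : ℂ)⁻¹) x :=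
    (hd.inner ℂ hU).inv h
  exact hW.sub ((h1.mul h2).smul hd)

/-- A frame model for the complement of two unit orthogonal vectors. -/
lemma exists_frame [FiniteDimensional ℂ H] (d : ℕ) (q₁ q₂ : H) (h1 : ‖q₁‖ = 1) (h2 : ‖q₂‖ = 1)
    (h12 : inner ℂ q₁ q₂ = 0) (hd : 2 * Module.finrank ℂ H = d + 4) :
    ∃ (k : EuclideanSpace ℝ (Fin d) →ₗᵢ[ℝ] H) (l : H →L[ℝ] EuclideanSpace ℝ (Fin d)),
      (∀ y, inner ℂ q₁ (k y) = 0) ∧ (∀ y, inner ℂ q₂ (k y) = 0) ∧ (∀ y, l (k y) = y) ∧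
      ∀ h, inner ℂ q₁ h = 0 → inner ℂ q₂ h = 0 → k (l h) = h := by
  classical
  have hon : Orthonormal ℂ ![q₁, q₂] := by
    have h21 : inner ℂ q₂ q₁ = 0 := by rw [← inner_conj_symm, h12]; simp
    rw [orthonormal_iff_ite]
    intro i j
    fin_cases i <;> fin_cases j <;> simp [h1, h2, h12, h21, inner_self_eq_norm_sq_to_K]
  let S : Submodule ℂ H := Submodule.span ℂ (Set.range ![q₁, q₂])
  have hS : Module.finrank ℂ S = 2 := by
    simpa using finrank_span_eq_card hon.linearIndependent
  have hM : Module.finrank ℂ Sᗮ + 2 = Module.finrank ℂ H := by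
    have := Submodule.finrank_add_finrank_orthogonal S
    omega
  have memM : ∀ h : H, h ∈ Sᗮ ↔ inner ℂ q₁ h = 0 ∧ inner ℂ q₂ h = 0 := by
    intro h
    constructor
    · intro hh
      exact ⟨hh _ (Submodule.subset_span ⟨0, rfl⟩), hh _ (Submodule.subset_span ⟨1, rfl⟩)⟩
    · rintro ⟨a, b⟩
      rw [Submodule.mem_orthogonal]
      intro u hu
      induction hu using Submodule.span_induction with
      | mem x hx =>
        obtain ⟨i, rfl⟩ := hx
        fin_cases i
        · exact a
        · exact b
      | zero => simp
      | add x y _ _ hx hy => rw [inner_add_left, hx, hy, add_zero]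
      | smul c x _ hx => rw [inner_smul_left, hx, mul_zero]
  have hr : Module.finrank ℝ Sᗮ = d := by
    rw [finrank_real_of_complex]; omega
  let _ : InnerProductSpace ℝ Sᗮ := InnerProductSpace.complexToReal
  let b := (stdOrthonormalBasis ℝ Sᗮ).reindex (finCongr hr)
  let kk : EuclideanSpace ℝ (Fin d) →ₗᵢ[ℝ] Sᗮ := b.repr.symm.toLinearIsometry
  let inc : Sᗮ →ₗᵢ[ℝ] H := ⟨Sᗮ.subtype.restrictScalars ℝ, fun _ => rfl⟩
  refine ⟨inc.comp kk,
    (b.repr.toContinuousLinearEquiv : Sᗮ →L[ℝ] _).comp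
      (Sᗮ.orthogonalProjectionOnto.restrictScalars ℝ), ?_, ?_, ?_, ?_⟩
  · intro y; exact ((memM _).1 (b.repr.symm y).2).1
  · intro y; exact ((memM _).1 (b.repr.symm y).2).2
  · intro y
    change b.repr (Sᗮ.orthogonalProjectionOnto (b.repr.symm y : H)) = y
    rw [Submodule.orthogonalProjectionOnto_mem_subspace_eq_self]; simp
  · intro h ha hb
    have hm := (memM h).2 ⟨ha, hb⟩
    change ((b.repr.symm (b.repr (Sᗮ.orthogonalProjectionOnto h)) : Sᗮ) : H) = h
    rw [LinearIsometryEquiv.symm_apply_apply]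
    exact Submodule.starProjection_eq_self_iff.2 hm
end

section wrappers
open scoped Manifold

lemma coe_sphere_smooth (p : ℕ) (m : WithTop ℕ∞) :
    ContMDiff (𝓡 p) 𝓘(ℝ, EuclideanSpace ℝ (Fin (p + 1))) m
      ((↑) : Metric.sphere (0 : EuclideanSpace ℝ (Fin (p + 1))) 1 →
        EuclideanSpace ℝ (Fin (p + 1))) := by
  have := Fact.mk (@finrank_euclideanSpace_fin ℝ _ (p + 1))
  exact contMDiff_coe_sphere

/-- A map of products of spheres given by an ambient smooth formula is smooth. -/
lemma smooth_into_sphere (p q r : ℕ)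
    (f : EuclideanSpace ℝ (Fin (p + 1)) × EuclideanSpace ℝ (Fin (q + 1)) →
      EuclideanSpace ℝ (Fin (r + 1)))
    (hm : ∀ z : Metric.sphere (0 : EuclideanSpace ℝ (Fin (p + 1))) 1 ×
         Metric.sphere (0 : EuclideanSpace ℝ (Fin (q + 1))) 1,
         f (z.1, z.2) ∈ Metric.sphere (0 : EuclideanSpace ℝ (Fin (r + 1))) 1)
    (hf : ∀ z : Metric.sphere (0 : EuclideanSpace ℝ (Fin (p + 1))) 1 ×
         Metric.sphere (0 : EuclideanSpace ℝ (Fin (q + 1))) 1,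
         ContDiffAt ℝ (⊤ : ℕ∞) f (z.1, z.2)) :
    ContMDiff ((𝓡 p).prod (𝓡 q)) (𝓡 r) (⊤ : ℕ∞)
      (fun z : Metric.sphere (0 : EuclideanSpace ℝ (Fin (p + 1))) 1 ×
         Metric.sphere (0 : EuclideanSpace ℝ (Fin (q + 1))) 1 =>
        (⟨f (z.1, z.2), hm z⟩ : Metric.sphere (0 : EuclideanSpace ℝ (Fin (r + 1))) 1)) := by
  have c1 : ContMDiff ((𝓡 p).prod (𝓡 q)) 𝓘(ℝ, EuclideanSpace ℝ (Fin (p + 1))) (⊤ : ℕ∞)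
      (fun z : Metric.sphere (0 : EuclideanSpace ℝ (Fin (p + 1))) 1 ×
        Metric.sphere (0 : EuclideanSpace ℝ (Fin (q + 1))) 1 =>
        (z.1 : EuclideanSpace ℝ (Fin (p + 1)))) :=
    (coe_sphere_smooth p _).comp contMDiff_fst
  have c2 : ContMDiff ((𝓡 p).prod (𝓡 q)) 𝓘(ℝ, EuclideanSpace ℝ (Fin (q + 1))) (⊤ : ℕ∞)
      (fun z : Metric.sphere (0 : EuclideanSpace ℝ (Fin (p + 1))) 1 ×
        Metric.sphere (0 : EuclideanSpace ℝ (Fin (q + 1))) 1 =>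
        (z.2 : EuclideanSpace ℝ (Fin (q + 1)))) :=
    (coe_sphere_smooth q _).comp contMDiff_snd
  have c12 := c1.prodMk_space c2
  have hc : ContMDiff ((𝓡 p).prod (𝓡 q)) 𝓘(ℝ, EuclideanSpace ℝ (Fin (r + 1))) (⊤ : ℕ∞)
      (fun z : Metric.sphere (0 : EuclideanSpace ℝ (Fin (p + 1))) 1 ×
        Metric.sphere (0 : EuclideanSpace ℝ (Fin (q + 1))) 1 => f (z.1, z.2)) :=
    fun z => (hf z).contMDiffAt.comp z (c12 z)
  have := Fact.mk (@finrank_euclideanSpace_fin ℝ _ (r + 1))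
  exact ContMDiff.codRestrict_sphere hc hm
end wrappers

section action
open scoped Manifold
variable {V H : Type*} [NormedAddCommGroup V] [InnerProductSpace ℂ V]
  [NormedAddCommGroup H] [InnerProductSpace ℂ H]

/-- The image of `(0, x)` after the first reflection. -/
def uvec (i₁ i₂ : V →ₗᵢ[ℂ] H) (b x : V) : H := cref (i₁ x) (i₂ b) (i₂ x)

/-- The unitary map straightening `(x,0), (0,x)`. -/
def Qmap (i₁ i₂ : V →ₗᵢ[ℂ] H) (a b x : V) (h : H) : H :=
  cref (uvec i₁ i₂ b x) (i₁ a) (cref (i₁ x) (i₂ b) h)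

/-- The inverse of `Qmap`. -/
def Pmap (i₁ i₂ : V →ₗᵢ[ℂ] H) (a b x : V) (h : H) : H :=
  cref (i₂ b) (i₁ x) (cref (i₁ a) (uvec i₁ i₂ b x) h)

structure Setup (i₁ i₂ : V →ₗᵢ[ℂ] H) (a b : V) : Prop where
  orth : ∀ v w, inner ℂ (i₁ v) (i₂ w) = 0
  na : ‖a‖ = 1
  nb : ‖b‖ = 1
  ab : inner ℂ a b = 0

namespace Setup
variable {i₁ i₂ : V →ₗᵢ[ℂ] H} {a b : V}

lemma orth' (s : Setup i₁ i₂ a b) (v w : V) : inner ℂ (i₂ v) (i₁ w) = 0 := by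
  rw [← inner_conj_symm, s.orth]; simp

lemma den1 (s : Setup i₁ i₂ a b) {x : V} (hx : ‖x‖ = 1) : inner ℂ (i₁ x - i₂ b) (i₁ x) = 1 := by
  rw [inner_sub_left, s.orth', LinearIsometry.inner_map_map, inner_self_eq_norm_sq_to_K, hx]
  simp

lemma den1_ne (s : Setup i₁ i₂ a b) {x : V} (hx : ‖x‖ = 1) : inner ℂ (i₁ x - i₂ b) (i₁ x) ≠ 0 := by
  rw [s.den1 hx]; exact one_ne_zero

lemma uvec_eq (s : Setup i₁ i₂ a b) {x : V} (hx : ‖x‖ = 1) :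
    uvec i₁ i₂ b x = i₂ x + (inner ℂ b x : ℂ) • (i₁ x - i₂ b) := by
  unfold uvec cref
  rw [s.den1 hx, inner_sub_left, s.orth, LinearIsometry.inner_map_map]
  simp

lemma nuvec (s : Setup i₁ i₂ a b) {x : V} (hx : ‖x‖ = 1) : ‖uvec i₁ i₂ b x‖ = 1 := by
  unfold uvec
  rw [cref_norm _ _ _ (by simpa using hx) (by simpa using s.nb) (s.den1_ne hx)]
  simpa using hx

lemma den2 (s : Setup i₁ i₂ a b) {x : V} (hx : ‖x‖ = 1) :
    inner ℂ (uvec i₁ i₂ b x - i₁ a) (uvec i₁ i₂ b x) = 1 - inner ℂ b x * inner ℂ a x := by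
  rw [inner_sub_left, inner_self_eq_norm_sq_to_K, s.nuvec hx, s.uvec_eq hx]
  rw [inner_add_right, s.orth, inner_smul_right, inner_sub_right, s.orth,
    LinearIsometry.inner_map_map]
  simp

lemma den2_ne (s : Setup i₁ i₂ a b) {x : V} (hx : ‖x‖ = 1) :
    inner ℂ (uvec i₁ i₂ b x - i₁ a) (uvec i₁ i₂ b x) ≠ 0 := by
  rw [s.den2 hx]
  intro h0
  have hba : inner ℂ b a = 0 := by rw [← inner_conj_symm, s.ab]; simp
  have hon : Orthonormal ℂ ![a, b] := by
    rw [orthonormal_iff_ite]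
    intro i j
    fin_cases i <;> fin_cases j <;> simp [s.na, s.nb, s.ab, hba, inner_self_eq_norm_sq_to_K]
  have hB := hon.sum_inner_products_le x (s := Finset.univ)
  simp only [Fin.sum_univ_two, Matrix.cons_val_zero, Matrix.cons_val_one, hx] at hB
  have h1 : ‖(inner ℂ b x : ℂ)‖ * ‖(inner ℂ a x : ℂ)‖ = 1 := by
    rw [← norm_mul, ← sub_eq_zero.1 h0, norm_one]
  nlinarith [sq_nonneg (‖(inner ℂ b x : ℂ)‖ - ‖(inner ℂ a x : ℂ)‖)]

lemma PQ (s : Setup i₁ i₂ a b) {x : V} (hx : ‖x‖ = 1) (h : H) : Pmap i₁ i₂ a b x (Qmap i₁ i₂ a b x h) = h := by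
  unfold Pmap Qmap
  rw [cref_inv _ _ _ (s.nuvec hx) (by simpa using s.na) (s.den2_ne hx),
    cref_inv _ _ _ (by simpa using hx) (by simpa using s.nb) (s.den1_ne hx)]

lemma den1_ne' (s : Setup i₁ i₂ a b) {x : V} (hx : ‖x‖ = 1) : inner ℂ (i₂ b - i₁ x) (i₂ b) ≠ 0 :=
  cref_den_ne _ _ (by simpa using hx) (by simpa using s.nb) (s.den1_ne hx)

lemma den2_ne' (s : Setup i₁ i₂ a b) {x : V} (hx : ‖x‖ = 1) : inner ℂ (i₁ a - uvec i₁ i₂ b x) (i₁ a) ≠ 0 :=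
  cref_den_ne _ _ (s.nuvec hx) (by simpa using s.na) (s.den2_ne hx)

lemma QP (s : Setup i₁ i₂ a b) {x : V} (hx : ‖x‖ = 1) (h : H) : Qmap i₁ i₂ a b x (Pmap i₁ i₂ a b x h) = h := by
  unfold Pmap Qmap
  rw [cref_inv _ _ _ (by simpa using s.nb) (by simpa using hx) (s.den1_ne' hx),
    cref_inv _ _ _ (by simpa using s.na) (s.nuvec hx) (s.den2_ne' hx)]

lemma Q_inner (s : Setup i₁ i₂ a b) {x : V} (hx : ‖x‖ = 1) (h k : H) :
    inner ℂ (Qmap i₁ i₂ a b x h) (Qmap i₁ i₂ a b x k) = inner ℂ h k := by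
  unfold Qmap
  rw [cref_inner _ _ _ _ (s.nuvec hx) (by simpa using s.na) (s.den2_ne hx),
    cref_inner _ _ _ _ (by simpa using hx) (by simpa using s.nb) (s.den1_ne hx)]

lemma Q_norm (s : Setup i₁ i₂ a b) {x : V} (hx : ‖x‖ = 1) (h : H) : ‖Qmap i₁ i₂ a b x h‖ = ‖h‖ := by
  unfold Qmap
  rw [cref_norm _ _ _ (s.nuvec hx) (by simpa using s.na) (s.den2_ne hx),
    cref_norm _ _ _ (by simpa using hx) (by simpa using s.nb) (s.den1_ne hx)]

lemma P_norm (s : Setup i₁ i₂ a b) {x : V} (hx : ‖x‖ = 1) (h : H) : ‖Pmap i₁ i₂ a b x h‖ = ‖h‖ := by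
  rw [← s.Q_norm hx, s.QP hx]

lemma Q_i₂ (s : Setup i₁ i₂ a b) {x : V} (hx : ‖x‖ = 1) : Qmap i₁ i₂ a b x (i₂ x) = i₁ a :=
  cref_self _ _ (s.den2_ne hx)

lemma Q_i₁ (s : Setup i₁ i₂ a b) {x : V} (hx : ‖x‖ = 1) : Qmap i₁ i₂ a b x (i₁ x) = i₂ b := by
  unfold Qmap
  rw [cref_self _ _ (s.den1_ne hx)]
  apply cref_fix
  rw [inner_sub_left, s.orth, s.uvec_eq hx, inner_add_left, inner_smul_left, inner_sub_left,
    s.orth, LinearIsometry.inner_map_map, LinearIsometry.inner_map_map, inner_conj_symm,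
    inner_self_eq_norm_sq_to_K, s.nb]
  simp

lemma smooth_uvec (s : Setup i₁ i₂ a b) {X : Type*} [NormedAddCommGroup X] [NormedSpace ℝ X] {m : WithTop ℕ∞}
    {f : X → V} {t : X} (hf : ContDiffAt ℝ m (fun y => i₁ (f y)) t)
    (hf' : ContDiffAt ℝ m (fun y => i₂ (f y)) t)
    (hx : ‖f t‖ = 1) : ContDiffAt ℝ m (fun y => uvec i₁ i₂ b (f y)) t :=
  cref_contDiffAt hf contDiffAt_const hf' (s.den1_ne hx)

lemma smooth_Q (s : Setup i₁ i₂ a b) {X : Type*} [NormedAddCommGroup X] [NormedSpace ℝ X] {m : WithTop ℕ∞}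
    {f : X → V} {h : X → H} {t : X} (hf : ContDiffAt ℝ m f t) (hh : ContDiffAt ℝ m h t)
    (hx : ‖f t‖ = 1) : ContDiffAt ℝ m (fun y => Qmap i₁ i₂ a b (f y) (h y)) t := by
  have h1 : ContDiffAt ℝ m (fun y => i₁ (f y)) t :=
    (i₁.toContinuousLinearMap.restrictScalars ℝ).contDiff.contDiffAt.comp t hf
  have h2 : ContDiffAt ℝ m (fun y => i₂ (f y)) t :=
    (i₂.toContinuousLinearMap.restrictScalars ℝ).contDiff.contDiffAt.comp t hf
  exact cref_contDiffAt (s.smooth_uvec h1 h2 hx) contDiffAt_const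
    (cref_contDiffAt h1 contDiffAt_const hh (s.den1_ne hx)) (s.den2_ne hx)

lemma smooth_P (s : Setup i₁ i₂ a b) {X : Type*} [NormedAddCommGroup X] [NormedSpace ℝ X] {m : WithTop ℕ∞}
    {f : X → V} {h : X → H} {t : X} (hf : ContDiffAt ℝ m f t) (hh : ContDiffAt ℝ m h t)
    (hx : ‖f t‖ = 1) : ContDiffAt ℝ m (fun y => Pmap i₁ i₂ a b (f y) (h y)) t := by
  have h1 : ContDiffAt ℝ m (fun y => i₁ (f y)) t :=
    (i₁.toContinuousLinearMap.restrictScalars ℝ).contDiff.contDiffAt.comp t hf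
  have h2 : ContDiffAt ℝ m (fun y => i₂ (f y)) t :=
    (i₂.toContinuousLinearMap.restrictScalars ℝ).contDiff.contDiffAt.comp t hf
  exact cref_contDiffAt contDiffAt_const h1
    (cref_contDiffAt contDiffAt_const (s.smooth_uvec h1 h2 hx) hh (s.den2_ne' hx))
    (s.den1_ne' hx)

end Setup

set_option maxHeartbeats 1000000 in
/-- The abstract form of the construction. -/
theorem abstract_action [FiniteDimensional ℂ V] [FiniteDimensional ℂ H]
    {i₁ i₂ : V →ₗᵢ[ℂ] H} {a b : V} (s : Setup i₁ i₂ a b)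
    (p q : ℕ) (hp : 2 * Module.finrank ℂ V = p + 1) (hq : 2 * Module.finrank ℂ H = q + 1 + 4)
    (hspan : ∀ z : H, ∃ v w, z = i₁ v + i₂ w)
    {Γ : Type*} [Group Γ] (φ : Γ →* (V ≃ₗᵢ[ℂ] V)) (D : Γ →* (H ≃ₗᵢ[ℂ] H))
    (hD1 : ∀ g v, D g (i₁ v) = i₁ (φ g v)) (hD2 : ∀ g v, D g (i₂ v) = i₂ (φ g v))
    (hfree : ∀ g, g ≠ 1 → ∀ x v : V, ‖x‖ = 1 → v ≠ 0 → inner ℂ x v = 0 →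
      φ g x = x → φ g v = v → False) :
    ∃ ρ : Γ →* Equiv.Perm
        (Metric.sphere (0 : EuclideanSpace ℝ (Fin (p + 1))) 1 ×
         Metric.sphere (0 : EuclideanSpace ℝ (Fin (q + 1))) 1),
      (∀ g : Γ, ContMDiff ((𝓡 p).prod (𝓡 q)) ((𝓡 p).prod (𝓡 q)) (⊤ : ℕ∞) (ρ g)) ∧
      (∀ g : Γ, g ≠ 1 → ∀ x, ρ g x ≠ x) := by
  classical
  obtain ⟨k, l, hk1, hk2, hlk, hkl⟩ := exists_frame (H := H) (q + 1) (i₂ b) (i₁ a)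
    (by simpa using s.nb) (by simpa using s.na) (s.orth' _ _) hq
  let _ : InnerProductSpace ℝ V := InnerProductSpace.complexToReal
  have hr : Module.finrank ℝ V = p + 1 := by rw [finrank_real_of_complex]; exact hp
  let J : EuclideanSpace ℝ (Fin (p + 1)) ≃ₗᵢ[ℝ] V :=
    ((stdOrthonormalBasis ℝ V).reindex (finCongr hr)).repr.symm
  -- ambient second component, with values in `H`
  let Z : Γ → V → H → H := fun g x h =>
    Qmap i₁ i₂ a b (φ g x) (D g (Pmap i₁ i₂ a b x h))
  have nφ : ∀ g x, ‖x‖ = 1 → ‖φ g x‖ = 1 := fun g x hx => by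
    rw [LinearIsometryEquiv.norm_map]; exact hx
  have Znorm : ∀ g x h, ‖x‖ = 1 → ‖Z g x h‖ = ‖h‖ := by
    intro g x h hx
    simp only [Z]
    rw [s.Q_norm (nφ g x hx), LinearIsometryEquiv.norm_map, s.P_norm hx]
  have Zorth : ∀ g x h, ‖x‖ = 1 → inner ℂ (i₂ b) h = 0 → inner ℂ (i₁ a) h = 0 →
      inner ℂ (i₂ b) (Z g x h) = 0 ∧ inner ℂ (i₁ a) (Z g x h) = 0 := by
    intro g x h hx hb ha
    simp only [Z]
    have key1 : inner ℂ (i₁ x) (Pmap i₁ i₂ a b x h) = 0 := by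
      rw [← s.Q_inner hx, s.QP hx, s.Q_i₁ hx, hb]
    have key2 : inner ℂ (i₂ x) (Pmap i₁ i₂ a b x h) = 0 := by
      rw [← s.Q_inner hx, s.QP hx, s.Q_i₂ hx, ha]
    constructor
    · rw [← s.Q_i₁ (nφ g x hx), s.Q_inner (nφ g x hx), ← hD1, LinearIsometryEquiv.inner_map_map,
        key1]
    · rw [← s.Q_i₂ (nφ g x hx), s.Q_inner (nφ g x hx), ← hD2, LinearIsometryEquiv.inner_map_map,
        key2]
  have nJ : ∀ x : Metric.sphere (0 : EuclideanSpace ℝ (Fin (p + 1))) 1,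
      ‖J (x : EuclideanSpace ℝ (Fin (p + 1)))‖ = 1 := by
    intro x
    rw [LinearIsometryEquiv.norm_map]; simpa using x.2
  let F1 : Γ → EuclideanSpace ℝ (Fin (p + 1)) → EuclideanSpace ℝ (Fin (p + 1)) :=
    fun g x => J.symm (φ g (J x))
  let F2 : Γ → EuclideanSpace ℝ (Fin (p + 1)) × EuclideanSpace ℝ (Fin (q + 1)) →
      EuclideanSpace ℝ (Fin (q + 1)) := fun g z => l (Z g (J z.1) (k z.2))
  have kF2 : ∀ g (x : Metric.sphere (0 : EuclideanSpace ℝ (Fin (p + 1))) 1) y,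
      k (F2 g (x, y)) = Z g (J x) (k y) := by
    intro g x y
    have := Zorth g (J x) (k y) (nJ x) (hk1 y) (hk2 y)
    exact hkl _ this.1 this.2
  have m1 : ∀ g (z : Metric.sphere (0 : EuclideanSpace ℝ (Fin (p + 1))) 1 ×
         Metric.sphere (0 : EuclideanSpace ℝ (Fin (q + 1))) 1),
         F1 g z.1 ∈ Metric.sphere (0 : EuclideanSpace ℝ (Fin (p + 1))) 1 := by
    intro g z
    simp only [F1, mem_sphere_zero_iff_norm, LinearIsometryEquiv.norm_map]
    exact mem_sphere_zero_iff_norm.1 z.1.2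
  have m2 : ∀ g (z : Metric.sphere (0 : EuclideanSpace ℝ (Fin (p + 1))) 1 ×
         Metric.sphere (0 : EuclideanSpace ℝ (Fin (q + 1))) 1),
         F2 g (z.1, z.2) ∈ Metric.sphere (0 : EuclideanSpace ℝ (Fin (q + 1))) 1 := by
    intro g z
    rw [mem_sphere_zero_iff_norm, ← k.norm_map, kF2, Znorm _ _ _ (nJ _), k.norm_map]
    exact mem_sphere_zero_iff_norm.1 z.2.2
  let F : Γ → (Metric.sphere (0 : EuclideanSpace ℝ (Fin (p + 1))) 1 ×
         Metric.sphere (0 : EuclideanSpace ℝ (Fin (q + 1))) 1) →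
        (Metric.sphere (0 : EuclideanSpace ℝ (Fin (p + 1))) 1 ×
         Metric.sphere (0 : EuclideanSpace ℝ (Fin (q + 1))) 1) :=
    fun g z => (⟨F1 g z.1, m1 g z⟩, ⟨F2 g (z.1, z.2), m2 g z⟩)
  have Fone : F 1 = id := by
    funext z
    refine Prod.ext (Subtype.ext ?_) (Subtype.ext ?_)
    · simp [F, F1]
    · apply k.injective
      change k (F2 1 (z.1, z.2)) = k z.2
      rw [kF2]
      simp only [Z, map_one, LinearIsometryEquiv.coe_one, id]
      rw [s.QP (nJ _)]
  have Fmul : ∀ g h, F (g * h) = F g ∘ F h := by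
    intro g h
    funext z
    refine Prod.ext (Subtype.ext ?_) (Subtype.ext ?_)
    · simp [F, F1]
    · apply k.injective
      change k (F2 (g * h) (z.1, z.2)) = k (F2 g ((F h z).1, (F h z).2))
      rw [kF2, kF2]
      have e1 : J ((F h z).1 : EuclideanSpace ℝ (Fin (p + 1))) = φ h (J z.1) := by
        simp [F, F1]
      have e2 : k ((F h z).2 : EuclideanSpace ℝ (Fin (q + 1))) = Z h (J z.1) (k z.2) :=
        kF2 h z.1 z.2
      rw [e1, e2]
      simp only [Z, map_mul, LinearIsometryEquiv.coe_mul, Function.comp]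
      rw [s.PQ (nφ h _ (nJ _))]
  let R : Γ →* Function.End (Metric.sphere (0 : EuclideanSpace ℝ (Fin (p + 1))) 1 ×
         Metric.sphere (0 : EuclideanSpace ℝ (Fin (q + 1))) 1) :=
    { toFun := F, map_one' := Fone, map_mul' := Fmul }
  refine ⟨R.toHomPerm, ?_, ?_⟩
  · intro g
    change ContMDiff ((𝓡 p).prod (𝓡 q)) ((𝓡 p).prod (𝓡 q)) (⊤ : ℕ∞) (F g)
    have φs : ContDiff ℝ (⊤ : ℕ∞) (fun v : V => φ g v) :=
      ((φ g).toContinuousLinearEquiv.toContinuousLinearMap.restrictScalars ℝ).contDiff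
    have Ds : ContDiff ℝ (⊤ : ℕ∞) (fun v : H => D g v) :=
      ((D g).toContinuousLinearEquiv.toContinuousLinearMap.restrictScalars ℝ).contDiff
    have s1 : ContDiff ℝ (⊤ : ℕ∞) (F1 g) :=
      J.symm.contDiff.comp (φs.comp J.contDiff)
    refine ContMDiff.prodMk ?_ ?_
    · exact smooth_into_sphere p q p (fun t => F1 g t.1) (m1 g)
        (fun z => (s1.comp contDiff_fst).contDiffAt)
    · refine smooth_into_sphere p q q (F2 g) (m2 g) ?_
      intro z
      have hJ : ContDiff ℝ (⊤ : ℕ∞) (fun t : EuclideanSpace ℝ (Fin (p + 1)) ×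
          EuclideanSpace ℝ (Fin (q + 1)) => J t.1) := J.contDiff.comp contDiff_fst
      have hK : ContDiff ℝ (⊤ : ℕ∞) (fun t : EuclideanSpace ℝ (Fin (p + 1)) ×
          EuclideanSpace ℝ (Fin (q + 1)) => k t.2) := k.contDiff.comp contDiff_snd
      have hφJ : ContDiff ℝ (⊤ : ℕ∞) (fun t : EuclideanSpace ℝ (Fin (p + 1)) ×
          EuclideanSpace ℝ (Fin (q + 1)) => φ g (J t.1)) := φs.comp hJ
      have hP := s.smooth_P (t := ((z.1 : EuclideanSpace ℝ (Fin (p + 1))),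
          (z.2 : EuclideanSpace ℝ (Fin (q + 1))))) hJ.contDiffAt hK.contDiffAt (nJ z.1)
      have hDP := Ds.contDiffAt.comp _ hP
      have hQ := s.smooth_Q hφJ.contDiffAt hDP (nφ g _ (nJ z.1))
      exact l.contDiff.contDiffAt.comp _ hQ
  · intro g hg z hz
    change F g z = z at hz
    have z1 : F1 g z.1 = z.1 := congrArg (fun t => (t.1 : EuclideanSpace ℝ (Fin (p + 1)))) hz
    have z2 : F2 g (z.1, z.2) = z.2 :=
      congrArg (fun t => (t.2 : EuclideanSpace ℝ (Fin (q + 1)))) hz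
    have hx := nJ z.1
    have fx : φ g (J z.1) = J z.1 := by
      conv_rhs => rw [← z1]
      simp [F1]
    have z3 : Z g (J z.1) (k z.2) = k z.2 := by rw [← kF2, z2]
    simp only [Z] at z3
    rw [fx] at z3
    have key1 : inner ℂ (i₁ (J z.1)) (Pmap i₁ i₂ a b (J z.1) (k z.2)) = 0 := by
      rw [← s.Q_inner hx, s.QP hx, s.Q_i₁ hx, hk1]
    have key2 : inner ℂ (i₂ (J z.1)) (Pmap i₁ i₂ a b (J z.1) (k z.2)) = 0 := by
      rw [← s.Q_inner hx, s.QP hx, s.Q_i₂ hx, hk2]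
    have hn : ‖Pmap i₁ i₂ a b (J z.1) (k z.2)‖ = 1 := by
      rw [s.P_norm hx, k.norm_map]
      exact mem_sphere_zero_iff_norm.1 z.2.2
    have hfix : D g (Pmap i₁ i₂ a b (J z.1) (k z.2)) = Pmap i₁ i₂ a b (J z.1) (k z.2) := by
      conv_rhs => rw [← z3]
      rw [s.PQ hx]
    obtain ⟨v, w, hvw⟩ := hspan (Pmap i₁ i₂ a b (J z.1) (k z.2))
    rw [hvw] at key1 key2 hn hfix
    rw [inner_add_right, s.orth, LinearIsometry.inner_map_map, add_zero] at key1
    rw [inner_add_right, s.orth', LinearIsometry.inner_map_map, zero_add] at key2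
    rw [map_add, hD1, hD2] at hfix
    have fd : i₁ (φ g v - v) + i₂ (φ g w - w) = 0 := by
      rw [map_sub, map_sub, ← add_sub_add_comm, hfix, sub_self]
    have fv : φ g v - v = 0 := by
      have := congrArg (fun t => inner ℂ (i₁ (φ g v - v)) t) fd
      simp only [inner_add_right, s.orth, add_zero, inner_zero_right] at this
      rw [LinearIsometry.inner_map_map] at this
      exact inner_self_eq_zero.1 this
    have fw : φ g w - w = 0 := by
      rw [fv, map_zero, zero_add] at fd
      exact i₂.injective (by rw [fd, map_zero])
    by_cases hv : v = 0
    · have hw : w ≠ 0 := by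
        rintro rfl
        simp [hv] at hn
      exact hfree g hg _ w hx hw key2 fx (sub_eq_zero.1 fw)
    · exact hfree g hg _ v hx hv key1 fx (sub_eq_zero.1 fv)
end action

section final

/-- A unitary matrix fixing two orthogonal vectors is conjugate into `U(n-2)`. -/
lemma exists_conj_block (n : ℕ) (hn : 2 ≤ n) (h : Matrix.unitaryGroup (Fin n) ℂ)
    (x v : EuclideanSpace ℂ (Fin n)) (hx : ‖x‖ = 1) (hv : v ≠ 0) (hxv : inner ℂ x v = 0)
    (fx : Matrix.mulVec (h : Matrix (Fin n) (Fin n) ℂ) x.ofLp = x.ofLp)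
    (fv : Matrix.mulVec (h : Matrix (Fin n) (Fin n) ℂ) v.ofLp = v.ofLp) :
    ∃ u : Matrix.unitaryGroup (Fin n) ℂ, u⁻¹ * h * u ∈ blockSet n (n - 2) := by
  classical
  let v' : EuclideanSpace ℂ (Fin n) := ((‖v‖ : ℂ)⁻¹) • v
  have hv0 : ‖v‖ ≠ 0 := norm_ne_zero_iff.2 hv
  have nv' : ‖v'‖ = 1 := by
    simp only [v', norm_smul, norm_inv, Complex.norm_real, norm_norm]
    exact inv_mul_cancel₀ hv0
  have hxv' : inner ℂ x v' = 0 := by simp only [v', inner_smul_right, hxv, mul_zero]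
  have hvx' : inner ℂ v' x = 0 := by rw [← inner_conj_symm, hxv']; simp
  have fv' : Matrix.mulVec (h : Matrix (Fin n) (Fin n) ℂ) v'.ofLp = v'.ofLp := by
    simp only [v', WithLp.ofLp_smul, Matrix.mulVec_smul, fv]
  let c : Fin n → EuclideanSpace ℂ (Fin n) := fun i => if (i : ℕ) = n - 1 then x else v'
  let S : Set (Fin n) := {i | n - 2 ≤ (i : ℕ)}
  have hc : Orthonormal ℂ (S.domRestrict c) := by
    rw [orthonormal_iff_ite]
    rintro ⟨i, hi⟩ ⟨j, hj⟩
    change n - 2 ≤ (i : ℕ) at hi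
    change n - 2 ≤ (j : ℕ) at hj
    have hi2 := i.2
    have hj2 := j.2
    simp only [Set.domRestrict_apply, c, Subtype.mk.injEq, Fin.ext_iff]
    split_ifs <;> first
      | omega
      | (simp [inner_self_eq_norm_sq_to_K, hx, nv', hxv', hvx'])
  obtain ⟨B, hB⟩ := hc.exists_orthonormalBasis_extension_of_card_eq
    (ι := Fin n) (by simp)
  have fB : ∀ j ∈ S, Matrix.mulVec (h : Matrix (Fin n) (Fin n) ℂ) (B j).ofLp = (B j).ofLp := by
    intro j hj
    rw [hB j hj]
    simp only [c]
    split_ifs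
    · exact fx
    · exact fv'
  let u : Matrix.unitaryGroup (Fin n) ℂ :=
    ⟨(EuclideanSpace.basisFun (Fin n) ℂ).toBasis.toMatrix B,
      (EuclideanSpace.basisFun (Fin n) ℂ).toMatrix_orthonormalBasis_mem_unitary B⟩
  have hu : ∀ i j, (u : Matrix (Fin n) (Fin n) ℂ) i j = B j i := by
    intro i j
    simp [u, Module.Basis.toMatrix_apply]
  have hcol : ∀ g : Matrix.unitaryGroup (Fin n) ℂ,
      (∀ j ∈ S, Matrix.mulVec (g : Matrix (Fin n) (Fin n) ℂ) (B j).ofLp = (B j).ofLp) →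
      ∀ i, ∀ j ∈ S, ((u⁻¹ * g * u : Matrix.unitaryGroup (Fin n) ℂ) :
        Matrix (Fin n) (Fin n) ℂ) i j = if i = j then 1 else 0 := by
    intro g hg i j hj
    have h1 : ∀ m, ((g : Matrix (Fin n) (Fin n) ℂ) * (u : Matrix (Fin n) (Fin n) ℂ)) m j
        = (u : Matrix (Fin n) (Fin n) ℂ) m j := by
      intro m
      have := congrFun (hg j hj) m
      rw [hu, ← this]
      simp only [Matrix.mul_apply, Matrix.mulVec, dotProduct, hu]
    have h2 : ((u⁻¹ * g * u : Matrix.unitaryGroup (Fin n) ℂ) : Matrix (Fin n) (Fin n) ℂ) i j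
        = ((u⁻¹ * u : Matrix.unitaryGroup (Fin n) ℂ) : Matrix (Fin n) (Fin n) ℂ) i j := by
      rw [mul_assoc]
      change (((u⁻¹ : Matrix.unitaryGroup (Fin n) ℂ) : Matrix (Fin n) (Fin n) ℂ) *
        ((g : Matrix (Fin n) (Fin n) ℂ) * (u : Matrix (Fin n) (Fin n) ℂ))) i j =
        (((u⁻¹ : Matrix.unitaryGroup (Fin n) ℂ) : Matrix (Fin n) (Fin n) ℂ) *
          (u : Matrix (Fin n) (Fin n) ℂ)) i j
      rw [Matrix.mul_apply, Matrix.mul_apply]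
      simp only [h1]
    rw [h2, inv_mul_cancel]
    exact Matrix.one_apply
  have finv : ∀ j ∈ S, Matrix.mulVec ((h⁻¹ : Matrix.unitaryGroup (Fin n) ℂ) :
      Matrix (Fin n) (Fin n) ℂ) (B j).ofLp = (B j).ofLp := by
    intro j hj
    have e : ((h⁻¹ : Matrix.unitaryGroup (Fin n) ℂ) : Matrix (Fin n) (Fin n) ℂ) *
        (h : Matrix (Fin n) (Fin n) ℂ) = 1 := congrArg Subtype.val (inv_mul_cancel h)
    conv_lhs => rw [← fB j hj]
    rw [Matrix.mulVec_mulVec, e, Matrix.one_mulVec]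
  refine ⟨u, ?_⟩
  intro i j hij
  by_cases hj : n - 2 ≤ (j : ℕ)
  · exact hcol h fB i j hj
  · have hi : n - 2 ≤ (i : ℕ) := by tauto
    have h3 := hcol h⁻¹ finv j i hi
    have e : u⁻¹ * h⁻¹ * u = (u⁻¹ * h * u)⁻¹ := by group
    rw [e] at h3
    have h4 : (starRingEnd ℂ) (((u⁻¹ * h * u : Matrix.unitaryGroup (Fin n) ℂ) :
        Matrix (Fin n) (Fin n) ℂ) i j) = if j = i then 1 else 0 := h3
    have h5 := congrArg (starRingEnd ℂ) h4
    rw [Complex.conj_conj] at h5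
    rw [h5]
    by_cases hji : i = j
    · simp [hji]
    · simp [hji, Ne.symm hji]

/-- Unitary matrices as linear isometries. -/
def unitaryIso (n : ℕ) : Matrix.unitaryGroup (Fin n) ℂ →*
    (EuclideanSpace ℂ (Fin n) ≃ₗᵢ[ℂ] EuclideanSpace ℂ (Fin n)) :=
  (Unitary.linearIsometryEquiv (𝕜 := ℂ) (H := EuclideanSpace ℂ (Fin n))).toMonoidHom.comp
    (Unitary.map
      ({ toFun := Matrix.toEuclideanCLM (n := Fin n) (𝕜 := ℂ)
         map_one' := map_one _
         map_mul' := map_mul _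
         map_star' := map_star _ } : Matrix (Fin n) (Fin n) ℂ →⋆*
          (EuclideanSpace ℂ (Fin n) →L[ℂ] EuclideanSpace ℂ (Fin n)))).toMonoidHom

lemma unitaryIso_apply (n : ℕ) (h : Matrix.unitaryGroup (Fin n) ℂ) (x : EuclideanSpace ℂ (Fin n)) :
    (unitaryIso n h x).ofLp = Matrix.mulVec (h : Matrix (Fin n) (Fin n) ℂ) x.ofLp := rfl

section double
variable (V : Type*) [NormedAddCommGroup V] [InnerProductSpace ℂ V]

/-- first inclusion -/
def inc₁ : V →ₗᵢ[ℂ] WithLp 2 (V × V) where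
  toFun v := WithLp.toLp 2 (v, 0)
  map_add' x y := by rw [← WithLp.toLp_add]; simp
  map_smul' c x := by simp [← WithLp.toLp_smul]
  norm_map' v := by simp

/-- second inclusion -/
def inc₂ : V →ₗᵢ[ℂ] WithLp 2 (V × V) where
  toFun v := WithLp.toLp 2 (0, v)
  map_add' x y := by rw [← WithLp.toLp_add]; simp
  map_smul' c x := by simp [← WithLp.toLp_smul]
  norm_map' v := by simp

/-- the diagonal action on the double -/
def dbl : (V ≃ₗᵢ[ℂ] V) →* (WithLp 2 (V × V) ≃ₗᵢ[ℂ] WithLp 2 (V × V)) where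
  toFun f := LinearIsometryEquiv.withLpProdCongr 2 f f
  map_one' := by ext z; rfl
  map_mul' f g := by ext z; rfl
end double

end final
end

/-- Let `G ⊆ U(n)` be a finite group whose `n`-dimensional representation
has fixity one, i.e. `G` acts freely on `U(n)/U(n-2)` (no nonidentity element of `G` is
conjugate into `U(n-2)`).  Then `G` acts freely and smoothly on
`S^{2n-1} × S^{4n-5}`. -/
theorem fixity_one_free_smooth_action (n : ℕ) (hn : 2 ≤ n)
    (G : Subgroup (Matrix.unitaryGroup (Fin n) ℂ)) [Finite G]
    (hfree : ∀ h ∈ G, h ≠ 1 → ∀ u : Matrix.unitaryGroup (Fin n) ℂ,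
      u⁻¹ * h * u ∉ blockSet n (n - 2)) :
    ∃ ρ : G →* Equiv.Perm
        (Metric.sphere (0 : EuclideanSpace ℝ (Fin ((2 * n - 1) + 1))) 1 ×
         Metric.sphere (0 : EuclideanSpace ℝ (Fin ((4 * n - 5) + 1))) 1),
      (∀ g : G, ContMDiff ((𝓡 (2 * n - 1)).prod (𝓡 (4 * n - 5)))
          ((𝓡 (2 * n - 1)).prod (𝓡 (4 * n - 5))) (⊤ : ℕ∞) (ρ g)) ∧
      (∀ g : G, g ≠ 1 → ∀ x, ρ g x ≠ x) := by
  have s : Setup (inc₁ (EuclideanSpace ℂ (Fin n))) (inc₂ (EuclideanSpace ℂ (Fin n)))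
      (EuclideanSpace.single ⟨0, by omega⟩ 1) (EuclideanSpace.single ⟨n - 1, by omega⟩ 1) :=
    { orth := fun v w => by simp [inc₁, inc₂]
      na := by simp
      nb := by simp
      ab := by
        rw [EuclideanSpace.inner_single_left]
        have : (0 : ℕ) ≠ n - 1 := by omega
        simp [this] }
  have hdim : Module.finrank ℂ (WithLp 2 (EuclideanSpace ℂ (Fin n) × EuclideanSpace ℂ (Fin n)))
      = n + n := by
    rw [(WithLp.linearEquiv 2 ℂ _).finrank_eq, Module.finrank_prod, finrank_euclideanSpace_fin]
  refine abstract_action s (2 * n - 1) (4 * n - 5) ?_ ?_ ?_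
    ((unitaryIso n).comp G.subtype) ((dbl _).comp ((unitaryIso n).comp G.subtype)) ?_ ?_ ?_
  · rw [finrank_euclideanSpace_fin]; omega
  · rw [hdim]; omega
  · intro z
    refine ⟨z.fst, z.snd, ?_⟩
    simp only [inc₁, inc₂, LinearIsometry.coe_mk, LinearMap.coe_mk, AddHom.coe_mk,
      ← WithLp.toLp_add]
    simp only [Prod.mk_add_mk, add_zero, zero_add]
    rfl
  · intro g v
    simp [dbl, inc₁]
  · intro g v
    simp [dbl, inc₂]
  · intro g hg x v hx hv hxv fx fv
    obtain ⟨u, hu⟩ := exists_conj_block n hn g x v hx hv hxv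
      (congrArg WithLp.ofLp fx) (congrArg WithLp.ofLp fv)
    exact hfree g g.2 (fun h => hg (Subtype.ext h)) u hu
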